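/- arXiv:2309.10793 — 2 statements merged into one kernel-verified Lean document; each statement's English description precedes it below -/
import Mathlib

section
/- Let V be a finite-dimensional complex vector space and let f : V → S be a linear map with rank(f*ω_S) = r − 1. Then the stabilizer {φ ∈ GO(S) : φ ∘ f = f} of f in GO(S) is contained in O(S) and has exactly two elements: the identity, and an involution of S that fixes the image f(V) pointwise. -/
open Module LinearMap

section

variable {K S V : Type*} [Field K] [AddCommGroup S] [Module K S] [FiniteDimensional K S]
  [AddCommGroup V] [Module K V] {ω : LinearMap.BilinForm K S} {f : V →ₗ[K] S}

/-- If the pullback of a nondegenerate form along `f` has corank one, then so does `f`. -/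
theorem finrank_range_of_finrank_range_pullback (hnd : ω.Nondegenerate)
    (hrank : finrank K (range (ω.compl₁₂ f f)) + 1 = finrank K S) :
    finrank K (range f) + 1 = finrank K S := by
  have hfac : ω.compl₁₂ f f = (f.dualMap ∘ₗ ω) ∘ₗ f := by ext; rfl
  have hle : finrank K (range (ω.compl₁₂ f f)) ≤ finrank K (range f) := by
    rw [hfac, range_comp]
    exact Submodule.finrank_map_le _ _
  have hle' : finrank K (range f) ≤ finrank K S := Submodule.finrank_le _
  have hne : finrank K (range f) ≠ finrank K S := by
    intro h
    have htop : range f = ⊤ := Submodule.eq_top_of_finrank_eq h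
    have hinj : Function.Injective (f.dualMap ∘ₗ ω) :=
      (dualMap_injective_of_surjective (range_eq_top.mp htop)).comp
        (ker_eq_bot.mp hnd.ker_eq_bot)
    rw [hfac, range_comp_of_range_eq_top _ htop, finrank_range_of_inj hinj] at hrank
    omega
  omega

/-- If the pullback of a form along `f` has the same rank as `f`, then the form is
nondegenerate on the range of `f`. -/
theorem eq_zero_of_forall_apply_range_eq_zero
    (hrank : finrank K (range (ω.compl₁₂ f f)) = finrank K (range f))
    {x : S} (hx : x ∈ range f) (h : ∀ v, ω x (f v) = 0) : x = 0 := by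
  let g : range f →ₗ[K] Dual K V := (f.dualMap ∘ₗ ω) ∘ₗ (range f).subtype
  have hg : range g = range (ω.compl₁₂ f f) := by
    have hfac : ω.compl₁₂ f f = (f.dualMap ∘ₗ ω) ∘ₗ f := by ext; rfl
    rw [hfac, range_comp, range_comp, Submodule.range_subtype]
  have hker : ker g = ⊥ := by
    have := finrank_range_add_finrank_ker g
    rw [hg, hrank] at this
    exact Submodule.finrank_eq_zero.mp (by omega)
  have hgx : (⟨x, hx⟩ : range f) ∈ ker g := by
    rw [mem_ker]
    ext v
    exact h v
  rw [hker, Submodule.mem_bot] at hgx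
  exact congrArg Subtype.val hgx

/-- If the pullback of a nondegenerate symmetric form along `f` has corank one, then the range
of `f` has an anisotropic vector spanning an orthogonal complement. -/
theorem exists_anisotropic_orthogonal_range (hsymm : ω.IsSymm) (hnd : ω.Nondegenerate)
    (hrank : finrank K (range (ω.compl₁₂ f f)) + 1 = finrank K S) :
    ∃ u : S, ω u u ≠ 0 ∧ (∀ v, ω u (f v) = 0) ∧ ∀ x, ∃ v, ∃ a : K, x = f v + a • u := by
  have hf := finrank_range_of_finrank_range_pullback hnd hrank
  have horth : finrank K (ω.orthogonal (range f)) = 1 := by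
    rw [BilinForm.finrank_orthogonal hnd]
    omega
  obtain ⟨⟨u, hu⟩, hu0, hspan⟩ := finrank_eq_one_iff'.mp horth
  have hdisj : Disjoint (range f) (ω.orthogonal (range f)) := by
    rw [Submodule.disjoint_def]
    intro x hx hx'
    refine eq_zero_of_forall_apply_range_eq_zero (ω := ω) (by omega) hx fun v => ?_
    rw [hsymm.eq]
    exact hx' (f v) ⟨v, rfl⟩
  have htop : range f ⊔ ω.orthogonal (range f) = ⊤ :=
    Submodule.eq_top_of_disjoint _ _ (by omega) hdisj
  have huf : ∀ v, ω u (f v) = 0 := fun v => by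
    rw [hsymm.eq]
    exact hu (f v) ⟨v, rfl⟩
  have hdec : ∀ x, ∃ v, ∃ a : K, x = f v + a • u := by
    intro x
    have hx : x ∈ range f ⊔ ω.orthogonal (range f) := htop ▸ Submodule.mem_top
    obtain ⟨_, ⟨v, rfl⟩, z, hz, rfl⟩ := Submodule.mem_sup.mp hx
    obtain ⟨a, ha⟩ := hspan ⟨z, hz⟩
    exact ⟨v, a, congrArg (f v + Subtype.val ·) ha.symm⟩
  refine ⟨u, fun huu => hu0 (Subtype.ext ?_), huf, hdec⟩
  refine (ker_eq_bot'.mp hnd.ker_eq_bot) u (LinearMap.ext fun x => ?_)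
  obtain ⟨v, a, rfl⟩ := hdec x
  simp [huf, huu]

end


/-- Let `S` be an `r`-dimensional complex vector space (`r` even, `r ≥ 2`)
with a nondegenerate symmetric bilinear form `ω`, and let `f : V → S` be a linear map whose
pullback form `f*ω` has rank `r - 1`.  Then the stabilizer of `f` in `GO(S)` is contained in
`O(S)` and consists of exactly two elements: the identity, and an involution of `S` fixing
the image `f(V)` pointwise. -/
theorem stabilizer_of_corank_one_map
    (r : ℕ) (hr : Even r) (hr2 : 2 ≤ r)
    (S : Type) [AddCommGroup S] [Module ℂ S] [FiniteDimensional ℂ S]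
    (hS : Module.finrank ℂ S = r)
    (ω : LinearMap.BilinForm ℂ S) (hsymm : ω.IsSymm) (hnd : ω.Nondegenerate)
    (V : Type) [AddCommGroup V] [Module ℂ V] [FiniteDimensional ℂ V]
    (f : V →ₗ[ℂ] S)
    (hrank : Module.finrank ℂ (LinearMap.range (ω.compl₁₂ f f)) = r - 1) :
    -- the stabilizer is contained in `O(S)`:
    (∀ φ : S ≃ₗ[ℂ] S, (∃ c : ℂˣ, ∀ v w : S, ω (φ v) (φ w) = (c : ℂ) * ω v w) →
      (∀ v : V, φ (f v) = f v) → (∀ v w : S, ω (φ v) (φ w) = ω v w)) ∧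
    -- the stabilizer has exactly two elements, the identity and an involution fixing `f(V)`:
    (∃ ψ : S ≃ₗ[ℂ] S, ψ ≠ LinearEquiv.refl ℂ S ∧ ψ.trans ψ = LinearEquiv.refl ℂ S ∧
      (∀ v : V, ψ (f v) = f v) ∧
      {φ : S ≃ₗ[ℂ] S | (∃ c : ℂˣ, ∀ v w : S, ω (φ v) (φ w) = (c : ℂ) * ω v w) ∧
        ∀ v : V, φ (f v) = f v} = {LinearEquiv.refl ℂ S, ψ}) := by
  obtain ⟨u, huu, huf, hdec⟩ := exists_anisotropic_orthogonal_range hsymm hnd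
    (show finrank ℂ (range (ω.compl₁₂ f f)) + 1 = finrank ℂ S by omega)
  have hfu : ∀ v, ω (f v) u = 0 := fun v => by rw [hsymm.eq, huf]
  obtain ⟨v₀, w₀, h₀⟩ : ∃ v w, ω (f v) (f w) ≠ 0 := by
    by_contra! h
    have hzero : ω.compl₁₂ f f = 0 := by
      ext v w
      exact h v w
    rw [hzero, range_zero, finrank_bot] at hrank
    omega
  have hO : ∀ φ : S ≃ₗ[ℂ] S, (∃ c : ℂˣ, ∀ v w : S, ω (φ v) (φ w) = (c : ℂ) * ω v w) →
      (∀ v : V, φ (f v) = f v) → ∀ v w : S, ω (φ v) (φ w) = ω v w := by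
    rintro φ ⟨c, hc⟩ hφ v w
    have h := hc (f v₀) (f w₀)
    rw [hφ, hφ] at h
    rw [hc, mul_right_cancel₀ h₀ (h.symm.trans (one_mul _).symm), one_mul]
  have hext : ∀ φ ψ : S ≃ₗ[ℂ] S, (∀ v, φ (f v) = f v) → (∀ v, ψ (f v) = f v) → φ u = ψ u →
      φ = ψ := by
    intro φ ψ hφ hψ h
    ext x
    obtain ⟨v, a, rfl⟩ := hdec x
    simp [hφ, hψ, h]
  have hcoroot : ((2 / ω u u) • ω u : Dual ℂ S) u = 2 := by simp [huu]
  have hψf : ∀ v, reflection hcoroot (f v) = f v := by simp [reflection_apply, huf]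
  have hψu : reflection hcoroot u = -u := reflection_apply_self hcoroot
  refine ⟨hO, reflection hcoroot, ?_, ?_, hψf, ?_⟩
  · intro h
    rw [h, LinearEquiv.refl_apply] at hψu
    have := congrArg (ω u) hψu
    rw [map_neg, self_eq_neg] at this
    exact huu this
  · ext x
    exact involutive_reflection hcoroot x
  · ext φ
    simp only [Set.mem_ofPred_eq, Set.mem_insert_iff, Set.mem_singleton_iff]
    constructor
    · rintro ⟨hc, hφ⟩
      have hiso := hO φ hc hφ
      obtain ⟨v, a, hva⟩ := hdec (φ u)
      have hfv : f v = 0 := by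
        refine eq_zero_of_forall_apply_range_eq_zero (ω := ω) (f := f) ?_ ⟨v, rfl⟩ fun w => ?_
        · have := finrank_range_of_finrank_range_pullback (f := f) hnd (by omega)
          omega
        · have h := hiso u (f w)
          simpa [hφ, hva, huf] using h
      rw [hfv, zero_add] at hva
      have ha : a * a = 1 := by
        have h := hiso u u
        rw [hva] at h
        simp only [map_smul, LinearMap.smul_apply, smul_eq_mul, ← mul_assoc] at h
        exact mul_right_cancel₀ huu (by rw [h, one_mul])
      rcases mul_self_eq_one_iff.mp ha with rfl | rfl
      · exact Or.inl (hext _ _ hφ (fun _ => rfl) (by simpa using hva))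
      · exact Or.inr (hext _ _ hφ hψf (by rw [hva, hψu, neg_one_smul]))
    · rintro (rfl | rfl)
      · exact ⟨⟨1, by simp⟩, fun _ => rfl⟩
      · refine ⟨⟨1, fun x y => ?_⟩, hψf⟩
        obtain ⟨v, a, rfl⟩ := hdec x
        obtain ⟨w, b, rfl⟩ := hdec y
        simp [hψf, hψu, huf, hfu]
end

section
/- Assume r ≥ 4. Let V be a finite-dimensional complex vector space and let f : V → S be a linear map such that the image f(V) has dimension r − 2 and the restriction of ω_S to f(V) is nondegenerate. Then the stabilizer {φ ∈ GO(S)° : φ ∘ f = f} of f in GO(S)° is isomorphic as a group to ℂˣ. -/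
open Matrix

noncomputable section

variable {r : ℕ}

/-- The orthogonal similitude group `GO(ω)` as a subgroup of `GL(r, ℂ)`:
invertible matrices `φ` with `φᵀ * ω * φ = c • ω` for some unit scalar `c`. -/
def GOmat (r : ℕ) (ω : Matrix (Fin r) (Fin r) ℂ) : Subgroup (GL (Fin r) ℂ) where
  carrier := {φ | ∃ c : ℂˣ,
    (φ : Matrix (Fin r) (Fin r) ℂ)ᵀ * ω * (φ : Matrix (Fin r) (Fin r) ℂ) = (c : ℂ) • ω}
  one_mem' := ⟨1, by simp⟩
  mul_mem' := by
    rintro φ ψ ⟨c, hc⟩ ⟨d, hd⟩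
    refine ⟨c * d, ?_⟩
    have h : ((φ * ψ : GL (Fin r) ℂ) : Matrix (Fin r) (Fin r) ℂ)
        = (φ : Matrix (Fin r) (Fin r) ℂ) * (ψ : Matrix (Fin r) (Fin r) ℂ) := rfl
    calc ((φ * ψ : GL (Fin r) ℂ) : Matrix (Fin r) (Fin r) ℂ)ᵀ * ω * (φ * ψ : GL (Fin r) ℂ)
        = (ψ : Matrix (Fin r) (Fin r) ℂ)ᵀ *
            (((φ : Matrix (Fin r) (Fin r) ℂ)ᵀ * ω * (φ : Matrix (Fin r) (Fin r) ℂ)) *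
              (ψ : Matrix (Fin r) (Fin r) ℂ)) := by
          rw [h, transpose_mul]; noncomm_ring
      _ = ((c : ℂ) * (d : ℂ)) • ω := by
          rw [hc, Matrix.smul_mul, Matrix.mul_smul, ← Matrix.mul_assoc, hd, smul_smul]
      _ = ((c * d : ℂˣ) : ℂ) • ω := by rw [Units.val_mul]
  inv_mem' := by
    rintro φ ⟨c, hc⟩
    refine ⟨c⁻¹, ?_⟩
    have h1 : ((φ⁻¹ : GL (Fin r) ℂ) : Matrix (Fin r) (Fin r) ℂ) *
        (φ : Matrix (Fin r) (Fin r) ℂ) = 1 := φ.inv_mul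
    have h2 : (φ : Matrix (Fin r) (Fin r) ℂ) *
        ((φ⁻¹ : GL (Fin r) ℂ) : Matrix (Fin r) (Fin r) ℂ) = 1 := φ.mul_inv
    have key : ω = (c : ℂ) • (((φ⁻¹ : GL (Fin r) ℂ) : Matrix (Fin r) (Fin r) ℂ)ᵀ * ω *
        ((φ⁻¹ : GL (Fin r) ℂ) : Matrix (Fin r) (Fin r) ℂ)) := by
      calc ω = (((φ : Matrix (Fin r) (Fin r) ℂ) *
              ((φ⁻¹ : GL (Fin r) ℂ) : Matrix (Fin r) (Fin r) ℂ))ᵀ) * ω *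
              ((φ : Matrix (Fin r) (Fin r) ℂ) *
              ((φ⁻¹ : GL (Fin r) ℂ) : Matrix (Fin r) (Fin r) ℂ)) := by
            rw [h2]; simp
        _ = ((φ⁻¹ : GL (Fin r) ℂ) : Matrix (Fin r) (Fin r) ℂ)ᵀ *
              (((φ : Matrix (Fin r) (Fin r) ℂ)ᵀ * ω * (φ : Matrix (Fin r) (Fin r) ℂ)) *
              ((φ⁻¹ : GL (Fin r) ℂ) : Matrix (Fin r) (Fin r) ℂ)) := by
            rw [transpose_mul]; noncomm_ring
        _ = (c : ℂ) • (((φ⁻¹ : GL (Fin r) ℂ) : Matrix (Fin r) (Fin r) ℂ)ᵀ * ω *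
              ((φ⁻¹ : GL (Fin r) ℂ) : Matrix (Fin r) (Fin r) ℂ)) := by
            rw [hc, Matrix.smul_mul, Matrix.mul_smul]; noncomm_ring
    calc ((φ⁻¹ : GL (Fin r) ℂ) : Matrix (Fin r) (Fin r) ℂ)ᵀ * ω * (φ⁻¹ : GL (Fin r) ℂ)
        = ((c⁻¹ : ℂˣ) : ℂ) • ((c : ℂ) • (((φ⁻¹ : GL (Fin r) ℂ) : Matrix (Fin r) (Fin r) ℂ)ᵀ *
            ω * ((φ⁻¹ : GL (Fin r) ℂ) : Matrix (Fin r) (Fin r) ℂ))) := by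
          rw [smul_smul]; norm_num
      _ = ((c⁻¹ : ℂˣ) : ℂ) • ω := by rw [← key]

/-- The orthogonal group `O(ω)` as a subgroup of `GL(r, ℂ)`. -/
def Omat (r : ℕ) (ω : Matrix (Fin r) (Fin r) ℂ) : Subgroup (GL (Fin r) ℂ) where
  carrier := {φ | (φ : Matrix (Fin r) (Fin r) ℂ)ᵀ * ω * (φ : Matrix (Fin r) (Fin r) ℂ) = ω}
  one_mem' := by simp
  mul_mem' := by
    intro φ ψ hφ hψ
    have h : ((φ * ψ : GL (Fin r) ℂ) : Matrix (Fin r) (Fin r) ℂ)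
        = (φ : Matrix (Fin r) (Fin r) ℂ) * (ψ : Matrix (Fin r) (Fin r) ℂ) := rfl
    show ((φ * ψ : GL (Fin r) ℂ) : Matrix (Fin r) (Fin r) ℂ)ᵀ * ω * (φ * ψ : GL (Fin r) ℂ) = ω
    calc ((φ * ψ : GL (Fin r) ℂ) : Matrix (Fin r) (Fin r) ℂ)ᵀ * ω * (φ * ψ : GL (Fin r) ℂ)
        = (ψ : Matrix (Fin r) (Fin r) ℂ)ᵀ *
            (((φ : Matrix (Fin r) (Fin r) ℂ)ᵀ * ω * (φ : Matrix (Fin r) (Fin r) ℂ)) *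
              (ψ : Matrix (Fin r) (Fin r) ℂ)) := by
          rw [h, transpose_mul]; noncomm_ring
      _ = ω := by
          rw [hφ, ← Matrix.mul_assoc]
          exact hψ
  inv_mem' := by
    intro φ hφ
    have h2 : (φ : Matrix (Fin r) (Fin r) ℂ) *
        ((φ⁻¹ : GL (Fin r) ℂ) : Matrix (Fin r) (Fin r) ℂ) = 1 := φ.mul_inv
    show ((φ⁻¹ : GL (Fin r) ℂ) : Matrix (Fin r) (Fin r) ℂ)ᵀ * ω * (φ⁻¹ : GL (Fin r) ℂ) = ω
    calc ((φ⁻¹ : GL (Fin r) ℂ) : Matrix (Fin r) (Fin r) ℂ)ᵀ * ω * (φ⁻¹ : GL (Fin r) ℂ)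
        = ((φ⁻¹ : GL (Fin r) ℂ) : Matrix (Fin r) (Fin r) ℂ)ᵀ *
            (((φ : Matrix (Fin r) (Fin r) ℂ)ᵀ * ω * (φ : Matrix (Fin r) (Fin r) ℂ)) *
            ((φ⁻¹ : GL (Fin r) ℂ) : Matrix (Fin r) (Fin r) ℂ)) := by
          rw [hφ, Matrix.mul_assoc]
      _ = (((φ : Matrix (Fin r) (Fin r) ℂ) *
            ((φ⁻¹ : GL (Fin r) ℂ) : Matrix (Fin r) (Fin r) ℂ))ᵀ) * ω *
            ((φ : Matrix (Fin r) (Fin r) ℂ) *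
            ((φ⁻¹ : GL (Fin r) ℂ) : Matrix (Fin r) (Fin r) ℂ)) := by
          rw [transpose_mul]; noncomm_ring
      _ = ω := by rw [h2]; simp

/-- The identity component `GO(ω)°`, as a subgroup of `GL(r, ℂ)`: the image in
`GL(r, ℂ)` of the connected component of the identity of `GO(ω)` (with its subspace
topology). -/
def GOmatConn (r : ℕ) (ω : Matrix (Fin r) (Fin r) ℂ) : Subgroup (GL (Fin r) ℂ) :=
  (Subgroup.connectedComponentOfOne (GOmat r ω)).map (GOmat r ω).subtype


/-- The stabilizer in `GO(ω)°` of a linear map `f : V → ℂʳ` (for the action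
`φ • f = φ ∘ f`). -/
def stabGOconn (r : ℕ) (ω : Matrix (Fin r) (Fin r) ℂ)
    {V : Type} [AddCommGroup V] [Module ℂ V] (f : V →ₗ[ℂ] (Fin r → ℂ)) :
    Subgroup (GOmatConn r ω) where
  carrier := {ψ | ∀ v : V,
    ((ψ : GL (Fin r) ℂ) : Matrix (Fin r) (Fin r) ℂ) *ᵥ (f v) = f v}
  one_mem' := by
    intro v
    show ((1 : GL (Fin r) ℂ) : Matrix (Fin r) (Fin r) ℂ) *ᵥ f v = f v
    simp
  mul_mem' := by
    intro a b ha hb v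
    have h : (((a * b : GOmatConn r ω) : GL (Fin r) ℂ) : Matrix (Fin r) (Fin r) ℂ)
        = ((a : GL (Fin r) ℂ) : Matrix (Fin r) (Fin r) ℂ) *
          ((b : GL (Fin r) ℂ) : Matrix (Fin r) (Fin r) ℂ) := rfl
    show (((a * b : GOmatConn r ω) : GL (Fin r) ℂ) : Matrix (Fin r) (Fin r) ℂ) *ᵥ f v = f v
    rw [h, ← Matrix.mulVec_mulVec, hb v, ha v]
  inv_mem' := by
    intro a ha v
    have hA : (((a : GL (Fin r) ℂ))⁻¹ : GL (Fin r) ℂ).val * ((a : GL (Fin r) ℂ)).val = 1 :=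
      Units.inv_mul _
    show (((a⁻¹ : GOmatConn r ω) : GL (Fin r) ℂ) : Matrix (Fin r) (Fin r) ℂ) *ᵥ f v = f v
    calc (((a⁻¹ : GOmatConn r ω) : GL (Fin r) ℂ) : Matrix (Fin r) (Fin r) ℂ) *ᵥ f v
        = (((a : GL (Fin r) ℂ))⁻¹ : GL (Fin r) ℂ).val *ᵥ
            (((a : GL (Fin r) ℂ)).val *ᵥ f v) := by rw [ha v]; rfl
      _ = ((((a : GL (Fin r) ℂ))⁻¹ : GL (Fin r) ℂ).val *
            ((a : GL (Fin r) ℂ)).val) *ᵥ f v := by rw [Matrix.mulVec_mulVec]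
      _ = f v := by rw [hA, Matrix.one_mulVec]

/-- A hyperbolic pair `u`, `v` for the bilinear form `B` that spans the orthogonal of the
subspace `W`, which is moreover a complement of `W`. -/
structure IsHyperbolicComplement {E : Type*} [AddCommGroup E] [Module ℂ E]
    (B : LinearMap.BilinForm ℂ E) (W : Submodule ℂ E) (u v : E) : Prop where
  left_self : B u u = 0
  right_self : B v v = 0
  left_right : B u v = 1
  right_left : B v u = 1
  left_ortho : ∀ w ∈ W, B u w = 0
  right_ortho : ∀ w ∈ W, B v w = 0
  sub_mem : ∀ x, x - (B v x • u + B u x • v) ∈ W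
  eq_of_ortho : ∀ x, (∀ w ∈ W, B w x = 0) → x = B v x • u + B u x • v

section Bilinear

variable {E : Type*} [AddCommGroup E] [Module ℂ E] {B : LinearMap.BilinForm ℂ E}

/-- The orthogonal of a nondegenerate subspace of codimension two is a hyperbolic plane. -/
lemma exists_isHyperbolicComplement [FiniteDimensional ℂ E] (hB : ∀ x y, B x y = B y x)
    (hnd : B.Nondegenerate) (W : Submodule ℂ E) (hW : (B.restrict W).Nondegenerate)
    (hdim : Module.finrank ℂ W + 2 = Module.finrank ℂ E) :
    ∃ u v, IsHyperbolicComplement B W u v := by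
  have hrefl : B.IsRefl := fun x y h => by rw [hB, h]
  have hcompl : IsCompl W (B.orthogonal W) :=
    LinearMap.BilinForm.isCompl_orthogonal_of_restrict_nondegenerate hrefl hW
  have hW' : (B.restrict (B.orthogonal W)).Nondegenerate := by
    rw [LinearMap.BilinForm.restrict_nondegenerate_iff_isCompl_orthogonal hrefl,
      LinearMap.BilinForm.orthogonal_orthogonal hnd hrefl]
    exact hcompl.symm
  have hrank : Module.finrank ℂ (B.orthogonal W) = 2 := by
    rw [LinearMap.BilinForm.finrank_orthogonal hnd]; omega
  have hsym : LinearMap.IsSymm (B.restrict (B.orthogonal W)) := ⟨fun x y => hB x y⟩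
  obtain ⟨b₀, hb₀⟩ := LinearMap.BilinForm.exists_orthogonal_basis hsym
  have hself := LinearMap.BilinForm.iIsOrtho.not_isOrtho_basis_self_of_nondegenerate hb₀ hW'
  obtain ⟨b, h0, h1, h01⟩ : ∃ b : Module.Basis (Fin 2) ℂ (B.orthogonal W),
      B (b 0) (b 0) ≠ 0 ∧ B (b 1) (b 1) ≠ 0 ∧ B (b 0) (b 1) = 0 := by
    refine ⟨b₀.reindex (finCongr hrank), ?_, ?_, ?_⟩
    · simpa using hself ((finCongr hrank).symm 0)
    · simpa using hself ((finCongr hrank).symm 1)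
    · have hne : (finCongr hrank).symm 0 ≠ (finCongr hrank).symm 1 := by simp
      simpa using hb₀ hne
  obtain ⟨p, hp⟩ := IsAlgClosed.exists_eq_mul_self (B (b 0) (b 0))
  obtain ⟨q, hq⟩ := IsAlgClosed.exists_eq_mul_self (B (b 1) (b 1))
  have hp0 : p ≠ 0 := by rintro rfl; simp [hp] at h0
  have hq0 : q ≠ 0 := by rintro rfl; simp [hq] at h1
  set e : E := p⁻¹ • (b 0 : E) with he
  set g : E := q⁻¹ • (b 1 : E) with hg
  have hee : B e e = 1 := by simp [he, hp]; field_simp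
  have hgg : B g g = 1 := by simp [hg, hq]; field_simp
  have heg : B e g = 0 := by simp [he, hg, h01]
  have hge : B g e = 0 := by rw [hB, heg]
  have heW : ∀ w ∈ W, B e w = 0 := fun w hw => by
    rw [hB, he, map_smul, (b 0).2 w hw, smul_zero]
  have hgW : ∀ w ∈ W, B g w = 0 := fun w hw => by
    rw [hB, hg, map_smul, (b 1).2 w hw, smul_zero]
  have hI := Complex.I_mul_I
  have hspan : ∀ x ∈ B.orthogonal W,
      x = B ((2⁻¹ : ℂ) • (e - Complex.I • g)) x • (e + Complex.I • g)
        + B (e + Complex.I • g) x • ((2⁻¹ : ℂ) • (e - Complex.I • g)) := by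
    intro x hx
    obtain ⟨α, β, rfl⟩ : ∃ α β : ℂ, x = α • e + β • g := by
      refine ⟨b.repr ⟨x, hx⟩ 0 * p, b.repr ⟨x, hx⟩ 1 * q, ?_⟩
      have := congrArg Subtype.val (b.sum_repr ⟨x, hx⟩)
      rw [Fin.sum_univ_two] at this
      simp only [Submodule.coe_add, Submodule.coe_smul] at this
      rw [he, hg, smul_smul, smul_smul, mul_assoc, mul_assoc, mul_inv_cancel₀ hp0,
        mul_inv_cancel₀ hq0, mul_one, mul_one, this]
    clear_value e g
    simp only [map_add, map_sub, map_smul, LinearMap.add_apply, LinearMap.sub_apply,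
      LinearMap.smul_apply, smul_eq_mul, hee, hgg, heg, hge]
    match_scalars
    · ring
    · linear_combination β * hI
  have huW : ∀ w ∈ W, B (e + Complex.I • g) w = 0 := fun w hw => by simp [heW w hw, hgW w hw]
  have hvW : ∀ w ∈ W, B ((2⁻¹ : ℂ) • (e - Complex.I • g)) w = 0 := fun w hw => by
    simp [heW w hw, hgW w hw]
  refine ⟨e + Complex.I • g, (2⁻¹ : ℂ) • (e - Complex.I • g),
    ⟨?_, ?_, ?_, ?_, huW, hvW, fun x => ?_, fun x hx => hspan x hx⟩⟩
  · simp [hee, hgg, heg, hge]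
  · simp [hee, hgg, heg, hge]
  · simp [hee, hgg, heg, hge]; norm_num
  · simp [hee, hgg, heg, hge]; norm_num
  · obtain ⟨w, hw, y, hy, rfl⟩ := Submodule.mem_sup.1
      (hcompl.sup_eq_top ▸ Submodule.mem_top : x ∈ W ⊔ B.orthogonal W)
    rw [map_add, map_add, huW w hw, hvW w hw, zero_add, zero_add, ← hspan y hy]
    simpa using hw

/-- The linear map fixing the orthogonal of `u` and `v`, which scales `u` by `t` and `v` by
`t⁻¹` when `u`, `v` is a hyperbolic pair. -/
def hyperbolicRotation (B : LinearMap.BilinForm ℂ E) (u v : E) (t : ℂˣ) : Module.End ℂ E :=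
  1 + ((t : ℂ) - 1) • (B v).smulRight u + ((t⁻¹ : ℂˣ) - 1 : ℂ) • (B u).smulRight v

lemma hyperbolicRotation_apply (u v : E) (t : ℂˣ) (x : E) :
    hyperbolicRotation B u v t x =
      x + (((t : ℂ) - 1) * B v x) • u + (((t⁻¹ : ℂˣ) - 1 : ℂ) * B u x) • v := by
  simp [hyperbolicRotation, smul_smul]

namespace IsHyperbolicComplement

variable {W : Submodule ℂ E} {u v : E}

lemma hom_ext (h : IsHyperbolicComplement B W u v) {φ ψ : Module.End ℂ E}
    (hW : ∀ w ∈ W, φ w = ψ w) (hu : φ u = ψ u) (hv : φ v = ψ v) : φ = ψ := by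
  ext x
  have hx := hW _ (h.sub_mem x)
  simpa [hu, hv] using hx

lemma hyperbolicRotation_apply_of_mem (h : IsHyperbolicComplement B W u v) (t : ℂˣ)
    {w : E} (hw : w ∈ W) : hyperbolicRotation B u v t w = w := by
  simp [hyperbolicRotation_apply, h.left_ortho w hw, h.right_ortho w hw]

lemma hyperbolicRotation_apply_left (h : IsHyperbolicComplement B W u v) (t : ℂˣ) :
    hyperbolicRotation B u v t u = (t : ℂ) • u := by
  rw [hyperbolicRotation_apply, h.right_left, h.left_self]
  module

lemma hyperbolicRotation_apply_right (h : IsHyperbolicComplement B W u v) (t : ℂˣ) :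
    hyperbolicRotation B u v t v = ((t⁻¹ : ℂˣ) : ℂ) • v := by
  rw [hyperbolicRotation_apply, h.right_self, h.left_right]
  module

lemma hyperbolicRotation_mul (h : IsHyperbolicComplement B W u v) (s t : ℂˣ) :
    hyperbolicRotation B u v (s * t) =
      hyperbolicRotation B u v s * hyperbolicRotation B u v t := by
  refine h.hom_ext (fun w hw => ?_) ?_ ?_
  · simp [h.hyperbolicRotation_apply_of_mem _ hw]
  · simp [h.hyperbolicRotation_apply_left, smul_smul, mul_comm]
  · simp [h.hyperbolicRotation_apply_right, smul_smul]

/-- Hyperbolic rotations as a one-parameter monoid of endomorphisms. -/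
def rotationHom (h : IsHyperbolicComplement B W u v) : ℂˣ →* Module.End ℂ E where
  toFun := hyperbolicRotation B u v
  map_one' := by simp [hyperbolicRotation]
  map_mul' := h.hyperbolicRotation_mul

lemma hyperbolicRotation_isometry (h : IsHyperbolicComplement B W u v)
    (hB : ∀ x y, B x y = B y x) (t : ℂˣ) (x y : E) :
    B (hyperbolicRotation B u v t x) (hyperbolicRotation B u v t y) = B x y := by
  have ht : (t : ℂ) * (t⁻¹ : ℂˣ) = 1 := t.mul_inv
  simp only [hyperbolicRotation_apply, map_add, map_smul, LinearMap.add_apply,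
    LinearMap.smul_apply, smul_eq_mul, h.left_self, h.right_self, h.left_right, h.right_left,
    hB x u, hB x v]
  linear_combination (B v x * B u y + B u x * B v y) * ht

lemma hyperbolicRotation_injective (h : IsHyperbolicComplement B W u v) :
    Function.Injective (hyperbolicRotation B u v) := by
  intro s t hst
  have hu : u ≠ 0 := by rintro rfl; simpa using h.left_right
  have := congrArg (fun φ => φ u) hst
  simp only [h.hyperbolicRotation_apply_left] at this
  exact Units.ext (smul_left_injective ℂ hu this)

/-- An isometry fixing `W` pointwise is either a hyperbolic rotation or
of determinant `-1`. -/
lemma exists_eq_hyperbolicRotation_or_det_eq_neg_one [FiniteDimensional ℂ E]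
    (h : IsHyperbolicComplement B W u v) {φ : Module.End ℂ E}
    (hB : ∀ x y, B x y = B y x) (hφ : ∀ x y, B (φ x) (φ y) = B x y) (hfix : ∀ w ∈ W, φ w = w) :
    (∃ t, φ = hyperbolicRotation B u v t) ∨ LinearMap.det φ = -1 := by
  have hortho : ∀ x, (∀ w ∈ W, B w x = 0) → φ x = B v (φ x) • u + B u (φ x) • v := by
    refine fun x hx => h.eq_of_ortho _ fun w hw => ?_
    rw [← hfix w hw, hφ, hx w hw]
  have hu := hortho u fun w hw => by rw [hB, h.left_ortho w hw]
  have hv := hortho v fun w hw => by rw [hB, h.right_ortho w hw]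
  have huu := hφ u u
  have hvv := hφ v v
  have huv := hφ u v
  generalize B v (φ u) = a at hu
  generalize B u (φ u) = b at hu
  generalize B v (φ v) = c at hv
  generalize B u (φ v) = d at hv
  rw [hu] at huu huv
  rw [hv] at hvv huv
  simp only [map_add, map_smul, LinearMap.add_apply, LinearMap.smul_apply, smul_eq_mul,
    h.left_self, h.right_self, h.left_right, h.right_left] at huu hvv huv
  have hab : a * b = 0 := by linear_combination huu / 2
  have hcd : c * d = 0 := by linear_combination hvv / 2
  have hdet : a * d + b * c = 1 := by linear_combination huv
  rcases mul_eq_zero.1 hab with rfl | rfl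
  · have hbc : b * c = 1 := by linear_combination hdet
    have hb : b ≠ 0 := left_ne_zero_of_mul_eq_one hbc
    have hc : c ≠ 0 := right_ne_zero_of_mul_eq_one hbc
    have hd : d = 0 := (mul_eq_zero.1 hcd).resolve_left hc
    have hcb : c = b⁻¹ := eq_inv_of_mul_eq_one_right hbc
    have hrefl : φ = LinearMap.transvection (b⁻¹ • B (u - b • v)) (u - b • v) := by
      refine h.hom_ext (fun w hw => ?_) ?_ ?_
      · simp [LinearMap.transvection.apply, hfix w hw, h.left_ortho w hw, h.right_ortho w hw]
      · simp [LinearMap.transvection.apply, hu, h.left_self, h.right_left, hb]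
      · simp [LinearMap.transvection.apply, hv, h.left_right, h.right_self, smul_sub, smul_smul,
          hb, hd, hcb]
    right
    rw [hrefl, LinearMap.transvection.det]
    simp only [map_sub, map_smul, LinearMap.sub_apply, LinearMap.smul_apply, smul_eq_mul,
      h.left_self, h.right_self, h.left_right, h.right_left]
    field_simp
    ring
  · have had : a * d = 1 := by linear_combination hdet
    have hc : c = 0 := (mul_eq_zero.1 hcd).resolve_right (right_ne_zero_of_mul_eq_one had)
    refine Or.inl ⟨Units.mkOfMulEqOne a d had, h.hom_ext (fun w hw => ?_) ?_ ?_⟩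
    · rw [hfix w hw, h.hyperbolicRotation_apply_of_mem _ hw]
    · simp [hu, h.hyperbolicRotation_apply_left]
    · have hda : d = a⁻¹ := eq_inv_of_mul_eq_one_right had
      simp [hv, h.hyperbolicRotation_apply_right, hc, hda]

end IsHyperbolicComplement

end Bilinear

lemma isPreconnected_univ_units_complex : IsPreconnected (Set.univ : Set ℂˣ) := by
  have hcont : Continuous fun z : ℂ => (⟨Complex.exp z, Complex.exp (-z),
      by rw [← Complex.exp_add]; simp, by rw [← Complex.exp_add]; simp⟩ : ℂˣ) := by
    rw [Units.continuous_iff]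
    exact ⟨Complex.continuous_exp, Complex.continuous_exp.comp continuous_neg⟩
  convert isPreconnected_range hcont
  refine (Set.eq_univ_of_forall fun t => ?_).symm
  obtain ⟨z, hz⟩ : (t : ℂ) ∈ Set.range Complex.exp := by simp
  exact ⟨z, Units.ext hz⟩

lemma trace_inv_mul_smul {ω : Matrix (Fin r) (Fin r) ℂ} (hω : IsUnit ω.det) (hr : r ≠ 0) (c : ℂ) :
    (ω⁻¹ * (c • ω)).trace / r = c := by
  rw [Matrix.mul_smul, Matrix.nonsing_inv_mul ω hω, Matrix.trace_smul, Matrix.trace_one]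
  simp [hr]

/-- On the identity component of `GO(ω)`, the determinant is the `r / 2`-th power of the
multiplier. -/
lemma det_eq_pow_of_mem_GOmatConn (hr : Even r) (hr0 : r ≠ 0) {ω : Matrix (Fin r) (Fin r) ℂ}
    (hω : IsUnit ω.det) {φ : GL (Fin r) ℂ} (hφ : φ ∈ GOmatConn r ω) {c : ℂ}
    (hc : (φ : Matrix (Fin r) (Fin r) ℂ)ᵀ * ω * (φ : Matrix (Fin r) (Fin r) ℂ) = c • ω) :
    (φ : Matrix (Fin r) (Fin r) ℂ).det = c ^ (r / 2) := by
  obtain ⟨g, hg, rfl⟩ := hφ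
  let mat : GOmat r ω → Matrix (Fin r) (Fin r) ℂ := fun g => (g : GL (Fin r) ℂ)
  have hmat : Continuous mat := Units.continuous_val.comp continuous_subtype_val
  let mult : GOmat r ω → ℂ := fun g => (ω⁻¹ * ((mat g)ᵀ * ω * mat g)).trace / r
  have hmult : Continuous mult := by fun_prop
  have hsq : ∀ g : GOmat r ω, (mat g).det ^ 2 = (mult g ^ (r / 2)) ^ 2 ∧ mult g ≠ 0 := by
    rintro ⟨g, d, hd⟩
    have hm : mult ⟨g, d, hd⟩ = d := by
      change (ω⁻¹ * ((g : Matrix (Fin r) (Fin r) ℂ)ᵀ * ω * g)).trace / r = d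
      rw [hd, trace_inv_mul_smul hω hr0]
    rw [hm]
    refine ⟨?_, d.ne_zero⟩
    have hdet := congrArg Matrix.det hd
    rw [Matrix.det_mul, Matrix.det_mul, Matrix.det_transpose, Matrix.det_smul,
      Fintype.card_fin] at hdet
    rw [← pow_mul, Nat.div_mul_cancel hr.two_dvd]
    refine mul_right_cancel₀ hω.ne_zero ?_
    rw [← hdet]
    simp only [mat]
    ring
  have key := isPreconnected_connectedComponent.eq_of_sq_eq
    (f := fun g => (mat g).det) (g := fun g => mult g ^ (r / 2))
    hmat.matrix_det.continuousOn (hmult.pow _).continuousOn (fun g _ => (hsq g).1)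
    (fun {g} _ => pow_ne_zero _ (hsq g).2) (mem_connectedComponent (x := (1 : GOmat r ω)))
    (by simp [mat, mult, Matrix.nonsing_inv_mul ω hω, hr0]) hg
  have hm : mult g = c := by
    change (ω⁻¹ * ((mat g)ᵀ * ω * mat g)).trace / r = c
    rw [show (mat g)ᵀ * ω * mat g = c • ω from hc, trace_inv_mul_smul hω hr0]
  rw [← hm]
  exact key

lemma toLinearMap₂'_mulVec_mulVec (ω A : Matrix (Fin r) (Fin r) ℂ) (x y : Fin r → ℂ) :
    Matrix.toLinearMap₂' ℂ ω (A *ᵥ x) (A *ᵥ y) = Matrix.toLinearMap₂' ℂ (Aᵀ * ω * A) x y := by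
  simp only [Matrix.toLinearMap₂'_apply', ← Matrix.mulVec_mulVec]
  rw [Matrix.mulVec_transpose, dotProduct_comm x, ← Matrix.dotProduct_mulVec, dotProduct_comm]

lemma transpose_mul_mul_eq_of_isometry {ω A : Matrix (Fin r) (Fin r) ℂ}
    (h : ∀ x y, Matrix.toLinearMap₂' ℂ ω (A *ᵥ x) (A *ᵥ y) = Matrix.toLinearMap₂' ℂ ω x y) :
    Aᵀ * ω * A = ω := by
  refine (Matrix.toLinearMap₂' (m := Fin r) (n := Fin r) (S₁ := ℂ) (S₂ := ℂ) (N₂ := ℂ)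
    ℂ).injective (LinearMap.ext₂ fun x y => ?_)
  rw [← toLinearMap₂'_mulVec_mulVec, h]

namespace IsHyperbolicComplement

variable {ω : Matrix (Fin r) (Fin r) ℂ} {W : Submodule ℂ (Fin r → ℂ)} {u v : Fin r → ℂ}

/-- Hyperbolic rotations of `ℂʳ` as invertible matrices. -/
def rotationGL (h : IsHyperbolicComplement (Matrix.toLinearMap₂' ℂ ω) W u v) :
    ℂˣ →* GL (Fin r) ℂ :=
  ((LinearMap.toMatrixAlgEquiv' (R := ℂ) (n := Fin r) : _ →* _).comp h.rotationHom).toHomUnits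

lemma coe_rotationGL (h : IsHyperbolicComplement (Matrix.toLinearMap₂' ℂ ω) W u v) (t : ℂˣ) :
    (h.rotationGL t : Matrix (Fin r) (Fin r) ℂ) =
      LinearMap.toMatrix' (hyperbolicRotation (Matrix.toLinearMap₂' ℂ ω) u v t) :=
  rfl

lemma rotationGL_mulVec (h : IsHyperbolicComplement (Matrix.toLinearMap₂' ℂ ω) W u v) (t : ℂˣ)
    (x : Fin r → ℂ) : (h.rotationGL t : Matrix (Fin r) (Fin r) ℂ) *ᵥ x =
      hyperbolicRotation (Matrix.toLinearMap₂' ℂ ω) u v t x := by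
  rw [coe_rotationGL, LinearMap.toMatrix'_mulVec]

lemma rotationGL_injective (h : IsHyperbolicComplement (Matrix.toLinearMap₂' ℂ ω) W u v) :
    Function.Injective h.rotationGL := fun _ _ hst =>
  h.hyperbolicRotation_injective (LinearMap.toMatrix'.injective (congrArg Units.val hst))

lemma continuous_rotationGL (h : IsHyperbolicComplement (Matrix.toLinearMap₂' ℂ ω) W u v) :
    Continuous h.rotationGL := by
  have hval : Continuous fun t => (h.rotationGL t : Matrix (Fin r) (Fin r) ℂ) := by
    simp only [coe_rotationGL, hyperbolicRotation, map_add, map_smul]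
    have h1 : Continuous fun t : ℂˣ => (t : ℂ) := Units.continuous_val
    have h2 : Continuous fun t : ℂˣ => ((t⁻¹ : ℂˣ) : ℂ) := h1.comp continuous_inv
    fun_prop
  refine Units.continuous_iff.2 ⟨hval, ?_⟩
  simp only [← map_inv]
  exact hval.comp continuous_inv

lemma rotationGL_mem_GOmat (h : IsHyperbolicComplement (Matrix.toLinearMap₂' ℂ ω) W u v)
    (hB : ∀ x y : Fin r → ℂ, Matrix.toLinearMap₂' ℂ ω x y = Matrix.toLinearMap₂' ℂ ω y x) (t : ℂˣ) :
    h.rotationGL t ∈ GOmat r ω := by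
  refine ⟨1, ?_⟩
  rw [Units.val_one, one_smul]
  refine transpose_mul_mul_eq_of_isometry fun x y => ?_
  rw [rotationGL_mulVec, rotationGL_mulVec, h.hyperbolicRotation_isometry hB]

lemma rotationGL_mem_GOmatConn (h : IsHyperbolicComplement (Matrix.toLinearMap₂' ℂ ω) W u v)
    (hB : ∀ x y : Fin r → ℂ, Matrix.toLinearMap₂' ℂ ω x y = Matrix.toLinearMap₂' ℂ ω y x) (t : ℂˣ) :
    h.rotationGL t ∈ GOmatConn r ω := by
  let ρ : ℂˣ →* GOmat r ω := h.rotationGL.codRestrict _ (h.rotationGL_mem_GOmat hB)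
  have hρ : Continuous ρ := h.continuous_rotationGL.subtype_mk _
  have hsub := (isPreconnected_univ_units_complex.image ρ hρ.continuousOn).subset_connectedComponent
    ⟨1, Set.mem_univ _, map_one ρ⟩
  exact ⟨ρ t, hsub ⟨t, Set.mem_univ _, rfl⟩, rfl⟩

end IsHyperbolicComplement

/-- Assume `r ≥ 4` (`r` even), and let `ω` be a nondegenerate symmetric
`r × r` matrix viewed as a bilinear form on `S = ℂʳ`.  If `f : V → S` is a linear map
whose image has dimension `r - 2` and such that the restriction of `ω` to the image is
nondegenerate, then the stabilizer of `f` in `GO(ω)°` is isomorphic as a group to `ℂˣ`. -/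
theorem stabilizer_closed_orbit_case
    (r : ℕ) (hr : Even r) (hr4 : 4 ≤ r)
    (ω : Matrix (Fin r) (Fin r) ℂ) (hsymm : ω.IsSymm) (hnd : IsUnit ω.det)
    (V : Type) [AddCommGroup V] [Module ℂ V] [FiniteDimensional ℂ V]
    (f : V →ₗ[ℂ] (Fin r → ℂ))
    (him : Module.finrank ℂ (LinearMap.range f) = r - 2)
    (hres : ((Matrix.toLinearMap₂' ℂ ω).compl₁₂ (LinearMap.range f).subtype
      (LinearMap.range f).subtype).Nondegenerate) :
    Nonempty (stabGOconn r ω f ≃* ℂˣ) := by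
  have hB : ∀ x y : Fin r → ℂ,
      Matrix.toLinearMap₂' ℂ ω x y = Matrix.toLinearMap₂' ℂ ω y x := fun x y => by
    rw [Matrix.toLinearMap₂'_apply', Matrix.toLinearMap₂'_apply', Matrix.dotProduct_mulVec,
      ← Matrix.mulVec_transpose, hsymm.eq, dotProduct_comm]
  obtain ⟨u, v, h⟩ := exists_isHyperbolicComplement hB
    (LinearMap.nondegenerate_toLinearMap₂'_of_det_ne_zero' hnd.ne_zero) (LinearMap.range f) hres
    (by rw [him, Module.finrank_fin_fun]; omega)
  have hfixed : ∀ t, (⟨h.rotationGL t, h.rotationGL_mem_GOmatConn hB t⟩ : GOmatConn r ω) ∈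
      stabGOconn r ω f := fun t x => by
    rw [h.rotationGL_mulVec, h.hyperbolicRotation_apply_of_mem t (LinearMap.mem_range_self f x)]
  let ρ : ℂˣ →* stabGOconn r ω f :=
    (h.rotationGL.codRestrict _ (h.rotationGL_mem_GOmatConn hB)).codRestrict _ hfixed
  refine ⟨(MulEquiv.ofBijective ρ ⟨fun s t hst => ?_, ?_⟩).symm⟩
  · exact h.rotationGL_injective (congrArg Subtype.val (congrArg Subtype.val hst))
  rintro ⟨⟨φ, hφ⟩, hstab⟩
  have hfix : ∀ w ∈ LinearMap.range f, (φ : Matrix (Fin r) (Fin r) ℂ) *ᵥ w = w := by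
    rintro _ ⟨x, rfl⟩
    exact hstab x
  obtain ⟨c, hc⟩ : φ ∈ GOmat r ω := by
    obtain ⟨g, -, rfl⟩ := hφ
    exact g.2
  have hscale : ∀ x y : Fin r → ℂ,
      Matrix.toLinearMap₂' ℂ ω ((φ : Matrix (Fin r) (Fin r) ℂ) *ᵥ x)
        ((φ : Matrix (Fin r) (Fin r) ℂ) *ᵥ y) = c * Matrix.toLinearMap₂' ℂ ω x y := fun x y => by
    rw [toLinearMap₂'_mulVec_mulVec, hc, map_smul]
    rfl
  have hc1 : (c : ℂ) = 1 := by
    have : Nontrivial (LinearMap.range f) := Module.nontrivial_of_finrank_pos (R := ℂ) (by omega)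
    obtain ⟨w, hw⟩ := exists_ne (0 : LinearMap.range f)
    obtain ⟨w', hw'⟩ : ∃ w' : LinearMap.range f,
        Matrix.toLinearMap₂' ℂ ω (w : Fin r → ℂ) (w' : Fin r → ℂ) ≠ 0 := by
      by_contra! hzero
      exact hw (hres.1 w hzero)
    have heq := hscale (w : Fin r → ℂ) (w' : Fin r → ℂ)
    rw [hfix w w.2, hfix w' w'.2] at heq
    exact (right_eq_mul₀ hw').1 heq
  have hdet := det_eq_pow_of_mem_GOmatConn hr (by omega) hnd hφ hc
  rw [hc1, one_pow] at hdet
  rcases h.exists_eq_hyperbolicRotation_or_det_eq_neg_one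
    (φ := Matrix.toLin' (φ : Matrix (Fin r) (Fin r) ℂ)) hB
    (fun x y => by simpa [hc1] using hscale x y) (by simpa using hfix) with ⟨t, ht⟩ | hneg
  · refine ⟨t, Subtype.ext (Subtype.ext (Units.ext ?_))⟩
    change (h.rotationGL t : Matrix (Fin r) (Fin r) ℂ) = φ
    rw [h.coe_rotationGL, ← ht, LinearMap.toMatrix'_toLin']
  · rw [LinearMap.det_toLin', hdet] at hneg
    norm_num at hneg
end
end
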